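/- Let α ≥ 0 be a real number and let β ≥ 1, n be integers. Suppose G maximizes the α-spectral radius ρ_α among all simple graphs on n vertices with matching number β, that n > 2β, and that the Tutte–Berge minimum min_{S ⊆ V(G)} ( n − o(G−S) + |S| ) is attained at S = ∅ (i.e., at a set S of size s = 0). Then G is isomorphic to the disjoint union K_{2β+1} ∪ K̄_{n−2β−1}. -/

import Mathlib

open scoped Classical

/-- The adjacency matrix of a graph, over ℝ. -/
noncomputable def adjMat {V : Type*} [Fintype V] (G : SimpleGraph V) : Matrix V V ℝ :=
  fun i j => if G.Adj i j then 1 else 0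

/-- The diagonal matrix of vertex degrees, over ℝ. -/
noncomputable def degMat {V : Type*} [Fintype V] (G : SimpleGraph V) : Matrix V V ℝ :=
  fun i j => if i = j then ((G.neighborSet i).ncard : ℝ) else 0

/-- The largest (real) eigenvalue of a matrix. -/
noncomputable def specRad {V : Type*} [Fintype V] (M : Matrix V V ℝ) : ℝ :=
  sSup {t : ℝ | ∃ v : V → ℝ, v ≠ 0 ∧ M.mulVec v = t • v}

/-- The α-spectral radius: the largest eigenvalue of A_α(G) = α·D(G) + A(G). -/
noncomputable def alphaRadius {V : Type*} [Fintype V] (α : ℝ) (G : SimpleGraph V) : ℝ :=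
  specRad (α • degMat G + adjMat G)

/-- The matching number of a graph. -/
noncomputable def matchingNumber {V : Type*} [Fintype V] (G : SimpleGraph V) : ℕ :=
  sSup {m : ℕ | ∃ M : G.Subgraph, M.IsMatching ∧ M.edgeSet.ncard = m}

/-- The join of two graphs. -/
def graphJoin {A B : Type*} (G : SimpleGraph A) (H : SimpleGraph B) : SimpleGraph (A ⊕ B) :=
  SimpleGraph.fromRel (fun x y => match x, y with
    | Sum.inl a, Sum.inl b => G.Adj a b
    | Sum.inr a, Sum.inr b => H.Adj a b
    | _, _ => True)

/-- The disjoint union of two graphs. -/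
def graphSum {A B : Type*} (G : SimpleGraph A) (H : SimpleGraph B) : SimpleGraph (A ⊕ B) :=
  SimpleGraph.fromRel (fun x y => match x, y with
    | Sum.inl a, Sum.inl b => G.Adj a b
    | Sum.inr a, Sum.inr b => H.Adj a b
    | _, _ => False)

/-- The number of odd components of G − S. -/
noncomputable def oddComponentsOutside {V : Type*} [Fintype V] (G : SimpleGraph V) (S : Set V) : ℕ :=
  Set.ncard {c : (G.induce Sᶜ).ConnectedComponent | Odd c.supp.ncard}

/-- The disjoint union of cliques K_{f 0} ∪ ⋯ ∪ K_{f (q-1)}. -/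
def cliquesUnion (q : ℕ) (f : Fin q → ℕ) : SimpleGraph (Σ i : Fin q, Fin (f i)) :=
  SimpleGraph.fromRel (fun x y => x.1 = y.1)

namespace SimpleGraph

lemma Iso.ncard_oddComponents_eq {V W : Type*} {G : SimpleGraph V} {H : SimpleGraph W}
    (φ : G ≃g H) : G.oddComponents.ncard = H.oddComponents.ncard := by
  have hsupp (c : G.ConnectedComponent) :
      (φ.connectedComponentEquiv c).supp.ncard = c.supp.ncard := by
    rw [← Nat.card_coe_set_eq, ← Nat.card_coe_set_eq]
    exact (Nat.card_congr (ConnectedComponent.isoEquivSupp φ c)).symm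
  rw [← Nat.card_coe_set_eq, ← Nat.card_coe_set_eq]
  exact Nat.card_congr (φ.connectedComponentEquiv.subtypeEquiv fun c => by
    simp only [oddComponents, Set.mem_ofPred_eq, hsupp])

namespace Subgraph

variable {V : Type*} [Fintype V] {G : SimpleGraph V} {M : G.Subgraph}

lemma IsMatching.two_mul_ncard_edgeSet (hM : M.IsMatching) :
    2 * M.edgeSet.ncard = M.verts.ncard := by
  have h := M.coe.sum_degrees_eq_twice_card_edges
  rw [Finset.sum_congr rfl (g := fun _ => 1) fun v _ => by
    rw [coe_degree]
    convert! isMatching_iff_forall_degree.1 hM v v.2] at h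
  have hedge : M.coe.edgeFinset.card = M.edgeSet.ncard := by
    rw [← Set.ncard_coe_finset, coe_edgeFinset, ← image_coe_edgeSet_coe,
      Set.ncard_image_of_injective _ (Sym2.map.injective Subtype.val_injective)]
  rw [← hedge, ← h]
  simp [Set.ncard_eq_toFinset_card']

end Subgraph

end SimpleGraph

section GraphJoin

variable {A B : Type*} {G : SimpleGraph A} {H : SimpleGraph B}

@[simp] lemma graphJoin_adj_inl_inl {a b : A} :
    (graphJoin G H).Adj (.inl a) (.inl b) ↔ G.Adj a b := by
  simpa [graphJoin, G.adj_comm b a] using G.ne_of_adj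

@[simp] lemma graphJoin_adj_inr_inr {a b : B} :
    (graphJoin G H).Adj (.inr a) (.inr b) ↔ H.Adj a b := by
  simpa [graphJoin, H.adj_comm b a] using H.ne_of_adj

@[simp] lemma graphJoin_adj_inl_inr {a : A} {b : B} : (graphJoin G H).Adj (.inl a) (.inr b) := by
  simp [graphJoin]

/-- If `U` contains the whole second summand, deleting `U` from the join leaves a graph induced
by `G`. -/
def graphJoinDeleteVertsIso {U : Set (A ⊕ B)}
    (hU : ∀ k, Sum.inr k ∈ U) :
    G.induce (Sum.inl ⁻¹' U)ᶜ ≃g ((⊤ : (graphJoin G H).Subgraph).deleteVerts U).coe where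
  toFun v := ⟨.inl v.1, trivial, v.2⟩
  invFun x := match x with
    | ⟨.inl v, h⟩ => ⟨v, h.2⟩
    | ⟨.inr k, h⟩ => (h.2 (hU k)).elim
  left_inv v := rfl
  right_inv := by
    rintro ⟨v | k, h⟩
    · rfl
    · exact (h.2 (hU k)).elim
  map_rel_iff' := by
    intro v w
    have hv : Sum.inl v.1 ∉ U := v.2
    have hw : Sum.inl w.1 ∉ U := w.2
    simp [hv, hw]

end GraphJoin

section MatchingNumber

variable {V : Type*} [Fintype V] {G : SimpleGraph V}

lemma ncard_edgeSet_le_matchingNumber {M : G.Subgraph} (hM : M.IsMatching) :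
    M.edgeSet.ncard ≤ matchingNumber G := by
  refine le_csSup ⟨Fintype.card V, ?_⟩ ⟨M, hM, rfl⟩
  rintro m ⟨M, hM, rfl⟩
  have := Set.ncard_le_card M.verts
  have := hM.two_mul_ncard_edgeSet
  simp only [Nat.card_eq_fintype_card] at *
  lia

lemma matchingNumber_le {b : ℕ} (h : ∀ M : G.Subgraph, M.IsMatching → M.verts.ncard ≤ 2 * b + 1) :
    matchingNumber G ≤ b := by
  refine csSup_le ⟨_, ⊥, by simp [SimpleGraph.Subgraph.IsMatching], rfl⟩ ?_
  rintro m ⟨M, hM, rfl⟩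
  have := h M hM
  have := hM.two_mul_ncard_edgeSet
  lia

/-- A perfect matching of the join of `G` with a complete graph on `d` vertices restricts to a
matching of `G` that misses at most `d` vertices. -/
lemma card_le_two_mul_matchingNumber_add {d : ℕ}
    {M : (graphJoin G (⊤ : SimpleGraph (Fin d))).Subgraph} (hM : M.IsPerfectMatching) :
    Fintype.card V ≤ 2 * matchingNumber G + d := by
  let N : G.Subgraph :=
    { verts := {v | ∃ w, M.Adj (.inl v) (.inl w)}
      Adj v w := M.Adj (.inl v) (.inl w)
      adj_sub := fun {v w} h => by
        simpa using M.adj_sub h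
      edge_vert := fun {v w} h => ⟨w, h⟩
      symm := ⟨fun v w h => M.adj_symm h⟩ }
  have hN : N.IsMatching := fun v ⟨w, hw⟩ =>
    ⟨w, hw, fun u hu => Sum.inl_injective (hM.1.eq_of_adj_left hu hw)⟩
  have hcompl (v : ↥(N.vertsᶜ)) : ∃ k : Fin d, M.Adj (.inl v.1) (.inr k) := by
    obtain ⟨x | k, hx, -⟩ := hM.1 (hM.2 (.inl v.1))
    · exact (v.2 ⟨x, hx⟩).elim
    · exact ⟨k, hx⟩
  choose f hf using hcompl
  have hinj : Function.Injective f := fun v w hvw => by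
    have := hf w
    rw [← hvw] at this
    exact Subtype.ext (Sum.inl_injective (hM.1.eq_of_adj_right (hf v) this))
  have hd : (N.vertsᶜ).ncard ≤ d := by
    rw [← Nat.card_coe_set_eq]
    simpa using Nat.card_le_card_of_injective f hinj
  have h1 := Set.ncard_add_ncard_compl N.verts
  have h2 := hN.two_mul_ncard_edgeSet
  have h3 := ncard_edgeSet_le_matchingNumber hN
  rw [Nat.card_eq_fintype_card] at h1
  lia

lemma ncard_oddComponents_deleteVerts_graphJoin_le_one {d : ℕ} {U : Set (V ⊕ Fin d)} {k : Fin d}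
    (hk : Sum.inr k ∉ U) :
    ((⊤ : (graphJoin G (⊤ : SimpleGraph (Fin d))).Subgraph).deleteVerts U).coe.oddComponents.ncard
      ≤ 1 := by
  set J := ((⊤ : (graphJoin G (⊤ : SimpleGraph (Fin d))).Subgraph).deleteVerts U).coe
  have hreach (x) : J.Reachable x ⟨.inr k, trivial, hk⟩ := by
    by_cases hx : x = ⟨.inr k, trivial, hk⟩
    · rw [hx]
    · refine SimpleGraph.Adj.reachable ?_
      obtain ⟨v | l, h⟩ := x
      · simp [J, hk, h.2]
      · have : l ≠ k := fun hlk => hx (by subst hlk; rfl)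
        simp [J, hk, h.2, this]
  refine (Set.ncard_le_one_iff (Set.toFinite _)).2 fun {a b} _ _ => ?_
  induction a, b using SimpleGraph.ConnectedComponent.ind₂ with
  | _ x y => exact SimpleGraph.ConnectedComponent.sound ((hreach x).trans (hreach y).symm)

/-- The case of the Tutte–Berge formula in which the minimum is attained at the empty set. -/
lemma card_le_two_mul_matchingNumber_add_oddComponents
    (h : ∀ T : Set V, oddComponentsOutside G T ≤ oddComponentsOutside G (∅ : Set V) + T.ncard) :
    Fintype.card V ≤ 2 * matchingNumber G + oddComponentsOutside G (∅ : Set V) := by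
  set d := oddComponentsOutside G (∅ : Set V) with hd
  suffices h' : ∃ M : (graphJoin G (⊤ : SimpleGraph (Fin d))).Subgraph, M.IsPerfectMatching by
    obtain ⟨M, hM⟩ := h'
    exact card_le_two_mul_matchingNumber_add hM
  refine SimpleGraph.tutte.2 fun U hU => ?_
  rw [SimpleGraph.IsTutteViolator] at hU
  by_cases hk : ∀ k : Fin d, Sum.inr k ∈ U
  · rw [← (graphJoinDeleteVertsIso hk).ncard_oddComponents_eq] at hU
    have hT := h (Sum.inl ⁻¹' U)
    have hcard : U.ncard = (Sum.inl ⁻¹' U : Set V).ncard + d := by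
      have : U = Sum.inl '' (Sum.inl ⁻¹' U : Set V) ∪ Sum.inr '' (Set.univ : Set (Fin d)) := by
        ext (v | k) <;> simp [hk]
      conv_lhs => rw [this]
      rw [Set.ncard_union_eq, Set.ncard_image_of_injective _ Sum.inl_injective,
        Set.ncard_image_of_injective _ Sum.inr_injective, Set.ncard_univ, Nat.card_fin]
      rw [Set.disjoint_left]
      rintro _ ⟨v, -, rfl⟩ ⟨k, -, hk⟩
      simp at hk
    change U.ncard < oddComponentsOutside G (Sum.inl ⁻¹' U) at hU
    lia
  · push Not at hk
    obtain ⟨k, hk⟩ := hk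
    have hle := ncard_oddComponents_deleteVerts_graphJoin_le_one (G := G) hk
    have hU0 : U = ∅ := by
      rw [← Set.ncard_eq_zero]
      lia
    have hodd := SimpleGraph.odd_ncard_oddComponents
      ((⊤ : (graphJoin G (⊤ : SimpleGraph (Fin d))).Subgraph).deleteVerts U).coe
    have hoddG := SimpleGraph.odd_ncard_oddComponents (G.induce (∅ : Set V)ᶜ)
    change Odd d ↔ _ at hoddG
    subst hU0
    have h1 : Nat.card ((∅ : Set V)ᶜ : Set V) = Fintype.card V := by
      simp
    have h2 : Nat.card ((⊤ : (graphJoin G (⊤ : SimpleGraph (Fin d))).Subgraph).deleteVerts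
        ∅).verts = Fintype.card V + d := by
      simp
    rw [h1] at hoddG
    rw [h2, show SimpleGraph.oddComponents _ = _ from rfl] at hodd
    have h3 : ((⊤ : (graphJoin G (⊤ : SimpleGraph (Fin d))).Subgraph).deleteVerts
        ∅).coe.oddComponents.ncard = 1 := by
      rw [Set.ncard_empty] at hU
      lia
    rw [h3, Nat.odd_add] at hodd
    have := hodd.1 odd_one
    grind

end MatchingNumber

lemma SimpleGraph.sum_ncard_supp {V : Type*} [Fintype V] (G : SimpleGraph V) :
    ∑ c : G.ConnectedComponent, c.supp.ncard = Fintype.card V := by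
  rw [Fintype.card_congr (Equiv.sigmaFiberEquiv G.connectedComponentMk).symm, Fintype.card_sigma]
  refine Finset.sum_congr rfl fun c _ => ?_
  rw [← Nat.card_coe_set_eq, ← Nat.card_eq_fintype_card]
  rfl

section Components

variable {V : Type*} [Fintype V] {G : SimpleGraph V}

lemma oddComponentsOutside_empty : oddComponentsOutside G (∅ : Set V) = G.oddComponents.ncard := by
  change (G.induce (∅ : Set V)ᶜ).oddComponents.ncard = _
  rw [Set.compl_empty]
  exact G.induceUnivIso.ncard_oddComponents_eq

/-- If the sum of `⌊|C| / 2⌋` over the components `C` is at most `b` and some component has at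
least `2 * b + 1` vertices, then it has exactly that many and contains all edges. -/
lemma ncard_supp_eq_and_adj_imp_mem {b : ℕ} (c : G.ConnectedComponent)
    (hc : 2 * b + 1 ≤ c.supp.ncard) (h : Fintype.card V ≤ 2 * b + G.oddComponents.ncard) :
    c.supp.ncard = 2 * b + 1 ∧ ∀ v w, G.Adj v w → v ∈ c.supp := by
  let f (d : G.ConnectedComponent) : ℕ := d.supp.ncard - if Odd d.supp.ncard then 1 else 0
  have hpos (d : G.ConnectedComponent) : 0 < d.supp.ncard :=
    (Set.ncard_pos (Set.toFinite _)).2 d.nonempty_supp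
  have hf (d : G.ConnectedComponent) :
      f d + (if Odd d.supp.ncard then 1 else 0) = d.supp.ncard := by
    have := hpos d
    dsimp only [f]
    split_ifs <;> lia
  have hodd : G.oddComponents.ncard
      = ∑ d : G.ConnectedComponent, if Odd d.supp.ncard then 1 else 0 := by
    rw [← Finset.card_filter, ← Set.ncard_coe_finset]
    congr
    ext d
    simp
  have hsum : ∑ d, f d ≤ 2 * b := by
    have := G.sum_ncard_supp
    rw [← Finset.sum_congr rfl fun d _ => hf d, Finset.sum_add_distrib, ← hodd] at this
    lia
  rw [← Finset.add_sum_erase _ _ (Finset.mem_univ c)] at hsum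
  have hfc := hf c
  have hrest : ∑ d ∈ Finset.univ.erase c, f d = 0 := by
    split_ifs at hfc <;> lia
  refine ⟨by split_ifs at hfc <;> lia, fun v w hvw => ?_⟩
  by_contra hv
  have hne : G.connectedComponentMk v ≠ c := hv
  have h0 := Finset.sum_eq_zero_iff.1 hrest _ (Finset.mem_erase.2 ⟨hne, Finset.mem_univ _⟩)
  have h1 : (G.connectedComponentMk v).supp.ncard ≤ 1 := by
    have := hf (G.connectedComponentMk v)
    split_ifs at this <;> lia
  rw [Set.ncard_le_one_iff (Set.toFinite _)] at h1
  exact hvw.ne (h1 rfl (SimpleGraph.ConnectedComponent.sound hvw.symm.reachable))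

end Components

/-- `G` is a clique on `s` together with isolated vertices. -/
def IsCliqueOn {V : Type*} (G : SimpleGraph V) (s : Set V) : Prop :=
  ∀ v w, G.Adj v w ↔ v ≠ w ∧ v ∈ s ∧ w ∈ s

lemma exists_isCliqueOn {V : Type*} (s : Set V) : ∃ H : SimpleGraph V, IsCliqueOn H s :=
  ⟨{ Adj v w := v ≠ w ∧ v ∈ s ∧ w ∈ s
     symm := ⟨fun _ _ h => ⟨h.1.symm, h.2.2, h.2.1⟩⟩
     loopless := ⟨fun _ h => h.1 rfl⟩ }, fun _ _ => Iff.rfl⟩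

section Spectral

variable {V : Type*} [Fintype V] {G : SimpleGraph V} {α : ℝ}

lemma finite_setOf_eigenvalue (M : Matrix V V ℝ) :
    {t : ℝ | ∃ v : V → ℝ, v ≠ 0 ∧ M.mulVec v = t • v}.Finite := by
  refine (Module.End.finite_hasEigenvalue (Matrix.toLin' M)).subset ?_
  rintro t ⟨v, hv, hMv⟩
  exact Module.End.hasEigenvalue_of_hasEigenvector
    (Module.End.hasEigenvector_iff.2 ⟨Module.End.mem_eigenspace_iff.2 (by simpa using hMv), hv⟩)

lemma alphaMat_mulVec_apply (v : V → ℝ) (i : V) :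
    (α • degMat G + adjMat G).mulVec v i
      = α * G.degree i * v i + ∑ j ∈ G.neighborFinset i, v j := by
  have hdeg : ((G.neighborSet i).ncard : ℝ) = G.degree i := by
    rw [Set.ncard_eq_toFinset_card', SimpleGraph.degree, SimpleGraph.neighborFinset]
  rw [Matrix.add_mulVec, Matrix.smul_mulVec]
  simp only [Pi.add_apply, Pi.smul_apply, smul_eq_mul, Matrix.mulVec, dotProduct, degMat, adjMat,
    hdeg, ite_mul, zero_mul, one_mul, Finset.sum_ite_eq, Finset.mem_univ, if_true, mul_assoc,
    SimpleGraph.neighborFinset_eq_filter, Finset.sum_filter]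

lemma IsCliqueOn.le_alphaRadius {s : Set V} {k : ℕ} (h : IsCliqueOn G s)
    (hs : s.ncard = k + 1) : (1 + α) * k ≤ alphaRadius α G := by
  refine le_csSup (finite_setOf_eigenvalue _).bddAbove ⟨s.indicator 1, ?_, ?_⟩
  · obtain ⟨x, hx⟩ : s.Nonempty := Set.nonempty_of_ncard_ne_zero (by lia)
    exact fun h0 => by simpa [hx] using congrFun h0 x
  · ext i
    rw [alphaMat_mulVec_apply]
    by_cases hi : i ∈ s
    · have hN : G.neighborFinset i = s.toFinset.erase i := by
        ext j
        simp [h i j, hi, eq_comm]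
      have hd : G.degree i = k := by
        rw [← SimpleGraph.card_neighborFinset_eq_degree, hN, Finset.card_erase_of_mem (by simpa),
          ← Set.ncard_eq_toFinset_card', hs, Nat.add_sub_cancel]
      have hsum : ∑ j ∈ G.neighborFinset i, s.indicator (1 : V → ℝ) j = k := by
        rw [Finset.sum_congr rfl (g := fun _ => (1 : ℝ)), Finset.sum_const,
          SimpleGraph.card_neighborFinset_eq_degree, hd]
        · simp
        · intro j hj
          have : j ∈ s := ((h i j).1 (by simpa using hj)).2.2
          simp [this]
      rw [hsum, hd]
      simp [hi]
      ring
    · have hN : G.neighborFinset i = ∅ := by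
        ext j
        simp [h i j, hi]
      simp [hN, hi]

/-- If the spectral radius is at least `(1 + α) * k`, the vertices where a top eigenvector is
maximal have degree at least `k`, and those of degree exactly `k` have all neighbours of the same
kind. -/
lemma exists_degree_ge_of_le_alphaRadius (hα : 0 ≤ α) {k : ℕ} (hk : 1 ≤ k)
    (h : (1 + α) * k ≤ alphaRadius α G) :
    ∃ S : Set V, S.Nonempty ∧ ∀ x ∈ S, k ≤ G.degree x ∧
      (G.degree x ≤ k → ∀ y, G.Adj x y → y ∈ S) := by
  have hk' : (1 : ℝ) ≤ k := by exact_mod_cast hk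
  have hne : {t : ℝ | ∃ v : V → ℝ, v ≠ 0 ∧
      (α • degMat G + adjMat G).mulVec v = t • v}.Nonempty := by
    by_contra hempty
    rw [Set.not_nonempty_iff_eq_empty] at hempty
    rw [alphaRadius, specRad, hempty, Real.sSup_empty] at h
    nlinarith
  obtain ⟨v, hv, hMv⟩ := hne.csSup_mem (finite_setOf_eigenvalue _)
  change _ = alphaRadius α G • v at hMv
  set r := alphaRadius α G
  obtain ⟨x₀, hx₀⟩ := Function.ne_iff.1 hv
  have : Nonempty V := ⟨x₀⟩
  obtain ⟨u, hu⟩ := Finite.exists_max fun x => |v x|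
  obtain ⟨w, hw, hMw, hmax⟩ : ∃ w : V → ℝ, 0 < w u ∧
      (α • degMat G + adjMat G).mulVec w = r • w ∧ ∀ x, w x ≤ w u := by
    have hpos : 0 < |v u| := (abs_pos.2 hx₀).trans_le (hu x₀)
    rcases abs_cases (v u) with ⟨habs, -⟩ | ⟨habs, -⟩ <;> rw [habs] at hpos hu
    · exact ⟨v, hpos, hMv, fun x => (le_abs_self _).trans (hu x)⟩
    · exact ⟨-v, hpos, by rw [Matrix.mulVec_neg, hMv, smul_neg],
        fun x => (neg_le_abs _).trans (hu x)⟩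
  refine ⟨{x | w x = w u}, ⟨u, rfl⟩, fun x (hx : w x = w u) => ?_⟩
  have heq : α * G.degree x * w u + ∑ j ∈ G.neighborFinset x, w j = r * w u := by
    rw [← hx, ← alphaMat_mulVec_apply, hMw, Pi.smul_apply, smul_eq_mul]
  have hconst : ∑ _j ∈ G.neighborFinset x, w u = G.degree x * w u := by simp
  have hle : ∑ j ∈ G.neighborFinset x, w j ≤ ∑ _j ∈ G.neighborFinset x, w u :=
    Finset.sum_le_sum fun j _ => hmax j
  have hrw := mul_le_mul_of_nonneg_right h hw.le
  refine ⟨?_, fun hd y hxy => ?_⟩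
  · have : (1 + α) * k * w u ≤ (1 + α) * G.degree x * w u := by linarith
    have := le_of_mul_le_mul_left (le_of_mul_le_mul_right this hw) (by linarith)
    exact_mod_cast this
  · have hd' : (G.degree x : ℝ) ≤ k := by exact_mod_cast hd
    have hge : ∑ _j ∈ G.neighborFinset x, w u ≤ ∑ j ∈ G.neighborFinset x, w j := by
      have := mul_le_mul_of_nonneg_right
        (mul_le_mul_of_nonneg_left hd' (by linarith : 0 ≤ 1 + α)) hw.le
      linarith
    exact (Finset.sum_eq_sum_iff_of_le fun j _ => hmax j).1 (hle.antisymm hge) y (by simpa)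

end Spectral

section IsCliqueOn

variable {V : Type*} [Fintype V] {G : SimpleGraph V} {s : Set V}

lemma IsCliqueOn.matchingNumber_eq {b : ℕ} (h : IsCliqueOn G s) (hs : s.ncard = 2 * b + 1) :
    matchingNumber G = b := by
  refine le_antisymm (matchingNumber_le fun M hM => ?_) ?_
  · rw [← hs]
    refine Set.ncard_le_ncard fun v hv => ?_
    obtain ⟨w, hw, -⟩ := hM hv
    exact ((h v w).1 (M.adj_sub hw)).2.1
  · obtain ⟨t, hts, ht⟩ := Set.exists_subset_card_eq (s := s) (n := 2 * b) (by lia)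
    have hclique : G.IsClique t := fun v hv w hw hvw => (h v w).2 ⟨hvw, hts hv, hts hw⟩
    obtain ⟨M, rfl, hM⟩ := (hclique.even_iff_exists_isMatching (Set.toFinite t)).1
      (by simp [ht])
    have := hM.two_mul_ncard_edgeSet
    have := ncard_edgeSet_le_matchingNumber hM
    lia

lemma IsCliqueOn.nonempty_iso {k l : ℕ} (h : IsCliqueOn G s) (hk : s.ncard = k)
    (hl : sᶜ.ncard = l) :
    Nonempty (G ≃g graphSum (⊤ : SimpleGraph (Fin k)) (⊥ : SimpleGraph (Fin l))) := by
  let e : Fin k ⊕ Fin l ≃ V :=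
    ((Finite.equivFinOfCardEq hk).symm.sumCongr (Finite.equivFinOfCardEq hl).symm).trans
      (Equiv.Set.sumCompl s)
  have hinl (a : Fin k) : e (.inl a) ∈ s := by simp [e]
  have hinr (a : Fin l) : e (.inr a) ∉ s := by
    change (((Finite.equivFinOfCardEq hl).symm a).1 : V) ∉ s
    exact ((Finite.equivFinOfCardEq hl).symm a).2
  refine ⟨SimpleGraph.Iso.symm ⟨e, ?_⟩⟩
  rintro (a | a) (b | b) <;> simp [h _ _, hinl, hinr, graphSum, eq_comm]

lemma isCliqueOn_supp {k : ℕ} {S : Set V} {c : G.ConnectedComponent} {u : V}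
    (huS : u ∈ S) (huc : u ∈ c.supp)
    (hS : ∀ x ∈ S, k ≤ G.degree x ∧ (G.degree x ≤ k → ∀ y, G.Adj x y → y ∈ S))
    (hc : c.supp.ncard = k + 1) (hadj : ∀ v w, G.Adj v w → v ∈ c.supp) :
    IsCliqueOn G c.supp := by
  have hsub (x : V) : G.neighborFinset x ⊆ c.supp.toFinset.erase x := fun y hy => by
    rw [SimpleGraph.mem_neighborFinset] at hy
    simpa [hy.ne.symm] using hadj y x hy.symm
  have hcard {x : V} (hx : x ∈ c.supp) : (c.supp.toFinset.erase x).card = k := by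
    rw [Finset.card_erase_of_mem (by simpa using hx), ← Set.ncard_eq_toFinset_card', hc,
      Nat.add_sub_cancel]
  have hdeg {x : V} (hx : x ∈ c.supp) : G.degree x ≤ k :=
    hcard hx ▸ Finset.card_le_card (hsub x)
  have hcS {x : V} (hx : x ∈ c.supp) : x ∈ S := by
    have hr : G.Reachable u x := SimpleGraph.ConnectedComponent.exact (huc.trans hx.symm)
    rw [SimpleGraph.reachable_iff_reflTransGen] at hr
    clear hx
    induction hr with
    | refl => exact huS
    | tail _ hyz ih => exact (hS _ ih).2 (hdeg (hadj _ _ hyz)) _ hyz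
  refine fun v w => ⟨fun hvw => ⟨hvw.ne, hadj v w hvw, hadj w v hvw.symm⟩, ?_⟩
  rintro ⟨hne, hv, hw⟩
  rw [← SimpleGraph.mem_neighborFinset,
    Finset.eq_of_subset_of_card_le (hsub v) ((hcard hv).trans_le (hS v (hcS hv)).1)]
  simpa [hne.symm] using hw

end IsCliqueOn

theorem stmt13 (α : ℝ) (hα : 0 ≤ α) (n β : ℕ) (hβ : 1 ≤ β)
    (G : SimpleGraph (Fin n)) (hm : matchingNumber G = β)
    (hmax : ∀ H : SimpleGraph (Fin n),
      matchingNumber H = β → alphaRadius α H ≤ alphaRadius α G)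
    (hn : 2 * β < n)
    (hTB : ∀ T : Set (Fin n),
      (n : ℤ) - oddComponentsOutside G (∅ : Set (Fin n)) ≤
        (n : ℤ) - oddComponentsOutside G T + T.ncard) :
    Nonempty (G ≃g graphSum (⊤ : SimpleGraph (Fin (2 * β + 1)))
      (⊥ : SimpleGraph (Fin (n - (2 * β + 1))))) := by
  have hodd : n ≤ 2 * β + G.oddComponents.ncard := by
    have := card_le_two_mul_matchingNumber_add_oddComponents (G := G) fun T => by
      have := hTB T
      lia
    rwa [hm, oddComponentsOutside_empty, Fintype.card_fin] at this
  obtain ⟨s, -, hs⟩ := Set.exists_subset_card_eq (s := (Set.univ : Set (Fin n)))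
    (n := 2 * β + 1) (by simpa using hn)
  obtain ⟨H, hH⟩ := exists_isCliqueOn s
  have hr : (1 + α) * ((2 * β : ℕ) : ℝ) ≤ alphaRadius α G :=
    (hH.le_alphaRadius hs).trans (hmax H (hH.matchingNumber_eq hs))
  obtain ⟨S, ⟨u, hu⟩, hS⟩ := exists_degree_ge_of_le_alphaRadius hα (by lia) hr
  have hbig : 2 * β + 1 ≤ (G.connectedComponentMk u).supp.ncard := by
    have hsub : insert u (G.neighborFinset u : Set (Fin n)) ⊆ (G.connectedComponentMk u).supp := by
      rintro x (rfl | hx)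
      · rfl
      · exact SimpleGraph.ConnectedComponent.sound
          (SimpleGraph.Adj.reachable (by simpa using hx)).symm
    have := Set.ncard_le_ncard hsub
    rw [Set.ncard_insert_of_notMem (by simp), Set.ncard_coe_finset] at this
    exact (Nat.succ_le_succ (hS u hu).1).trans this
  obtain ⟨hc, hadj⟩ := ncard_supp_eq_and_adj_imp_mem _ hbig (by simpa using hodd)
  refine (isCliqueOn_supp hu rfl hS hc hadj).nonempty_iso hc ?_
  rw [Set.ncard_compl, hc, Nat.card_fin]
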